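/- (a) (S_n − n(p−q)X_1) / √(n(p + q − (p−q)²)) converges in distribution, as n → ∞, to the mixture measure (p+q)·N(0,1) + r·δ_0; and (b) (S_n − n(p−q)X_1) / n → 0 almost surely as n → ∞. -/

import Mathlib

open MeasureTheory ProbabilityTheory Filter Real
open scoped ENNReal NNReal Topology Classical

noncomputable section

/-- The σ-algebra `σ(X_1, …, X_n)` generated by the first `n` steps. -/
def sigmaUpTo {Ω : Type*} (X : ℕ → Ω → ℝ) (n : ℕ) : MeasurableSpace Ω :=
  MeasurableSpace.comap (fun ω (k : Fin n) => X ((k : ℕ) + 1) ω) inferInstance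

/-- Weak convergence of a sequence of measures on `ℝ` (convergence in distribution):
integrals of every bounded continuous function converge. -/
def TendstoInDist (μs : ℕ → Measure ℝ) (ν : Measure ℝ) : Prop :=
  ∀ f : BoundedContinuousFunction ℝ ℝ,
    Tendsto (fun n => ∫ x, f x ∂(μs n)) atTop (𝓝 (∫ x, f x ∂ν))

/-- The law on `{1, -1, 0}` with masses `a`, `b`, `1 - a - b`. -/
def stepLaw (a b : ℝ) : Measure ℝ :=
  ENNReal.ofReal a • Measure.dirac 1 + ENNReal.ofReal b • Measure.dirac (-1)
    + ENNReal.ofReal (1 - a - b) • Measure.dirac 0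

lemma integral_stepLaw {a b : ℝ} (ha : 0 ≤ a) (hb : 0 ≤ b) (hab : a + b ≤ 1) (f : ℝ → ℝ) :
    ∫ x, f x ∂(stepLaw a b) = a * f 1 + b * f (-1) + (1 - a - b) * f 0 := by
  have hi : ∀ (c d : ℝ), Integrable f (ENNReal.ofReal c • Measure.dirac d) := fun c d =>
    (integrable_dirac (by simp)).smul_measure ENNReal.ofReal_ne_top
  unfold stepLaw
  rw [integral_add_measure ((hi _ _).add_measure (hi _ _)) (hi _ _),
    integral_add_measure (hi _ _) (hi _ _)]
  simp only [integral_smul_measure, integral_dirac, smul_eq_mul]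
  rw [ENNReal.toReal_ofReal ha, ENNReal.toReal_ofReal hb, ENNReal.toReal_ofReal (by linarith)]

/-- Factorisation property of the new step given the past. -/
structure StepHyp {Ω : Type*} [MeasurableSpace Ω] (Q : Measure Ω) (Y : ℕ → Ω → ℝ)
    (F : ℕ → MeasurableSpace Ω) (a b : ℝ) : Prop where
  meas : ∀ n, Measurable (Y n)
  val : ∀ n ω, Y n ω = 1 ∨ Y n ω = -1 ∨ Y n ω = 0
  le : ∀ n, F n ≤ ‹MeasurableSpace Ω›
  adapt : ∀ k n, k < n → Measurable[F n] (Y k)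
  one : ∀ n A, MeasurableSet[F n] A → Q.real (A ∩ {ω | Y n ω = 1}) = a * Q.real A
  neg : ∀ n A, MeasurableSet[F n] A → Q.real (A ∩ {ω | Y n ω = -1}) = b * Q.real A

section core
variable {Ω : Type*} [MeasurableSpace Ω] {Q : Measure Ω} [IsProbabilityMeasure Q]
  {Y : ℕ → Ω → ℝ} {F : ℕ → MeasurableSpace Ω} {a b : ℝ}

lemma StepHyp.split (h : StepHyp Q Y F a b) (n : ℕ) {A B : Set Ω} (hA : MeasurableSet A)
    (hB : MeasurableSet B) : Q.real (A ∩ B) = Q.real (A ∩ B ∩ {ω | Y n ω = 1})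
      + Q.real (A ∩ B ∩ {ω | Y n ω = -1}) + Q.real (A ∩ B ∩ {ω | Y n ω = 0}) := by
  have m1 : ∀ v : ℝ, MeasurableSet {ω | Y n ω = v} := fun v =>
    h.meas n (measurableSet_singleton v)
  have hAB := hA.inter hB
  rw [← measureReal_union _ (hAB.inter (m1 _)), ← measureReal_union _ (hAB.inter (m1 _))]
  · congr 1
    ext ω
    have := h.val n ω
    simp only [Set.mem_inter_iff, Set.mem_union, Set.mem_ofPred_eq]
    tauto
  · rw [Set.disjoint_left]
    rintro ω (⟨_, h1⟩ | ⟨_, h1⟩) ⟨_, h2⟩ <;> simp only [Set.mem_ofPred_eq] at h1 h2 <;>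
      rw [h1] at h2 <;> norm_num at h2
  · rw [Set.disjoint_left]
    rintro ω ⟨_, h1⟩ ⟨_, h2⟩
    simp only [Set.mem_ofPred_eq] at h1 h2
    rw [h1] at h2; norm_num at h2

lemma StepHyp.fact (h : StepHyp Q Y F a b) (ha : 0 ≤ a) (hb : 0 ≤ b) (hab : a + b ≤ 1)
    (n : ℕ) {A : Set Ω} (hA : MeasurableSet[F n] A)
    {B : Set ℝ} (hB : MeasurableSet B) :
    Q.real (A ∩ Y n ⁻¹' B) = Q.real A * (stepLaw a b).real B := by
  have hA' := h.le n _ hA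
  have h1 := h.one n A hA
  have h2 := h.neg n A hA
  have h0 : Q.real (A ∩ {ω | Y n ω = 0}) = (1 - a - b) * Q.real A := by
    have := h.split n hA' MeasurableSet.univ
    simp only [Set.inter_univ] at this
    linarith
  have key : ∀ v : ℝ, Q.real (A ∩ Y n ⁻¹' B ∩ {ω | Y n ω = v})
      = B.indicator (fun _ => Q.real (A ∩ {ω | Y n ω = v})) v := by
    intro v
    by_cases hv : v ∈ B
    · rw [Set.indicator_of_mem hv]
      congr 1
      ext ω
      simp only [Set.mem_inter_iff, Set.mem_preimage, Set.mem_ofPred_eq]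
      constructor
      · tauto
      · rintro ⟨h1, rfl⟩; exact ⟨⟨h1, hv⟩, rfl⟩
    · rw [Set.indicator_of_notMem hv]
      convert measureReal_empty
      ext ω
      simp only [Set.mem_inter_iff, Set.mem_preimage, Set.mem_ofPred_eq, Set.mem_empty_iff_false,
        iff_false]
      rintro ⟨⟨_, h1⟩, rfl⟩; exact hv h1
  have hint : (stepLaw a b).real B = ∫ x, B.indicator (fun _ => (1 : ℝ)) x ∂(stepLaw a b) := by
    rw [integral_indicator hB]; simp
  rw [h.split n hA' (h.meas n hB), key, key, key, h1, h2, h0, hint,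
    integral_stepLaw ha hb hab]
  simp only [Set.indicator]
  split_ifs <;> ring

lemma StepHyp.law (h : StepHyp Q Y F a b) (ha : 0 ≤ a) (hb : 0 ≤ b) (hab : a + b ≤ 1)
    (n : ℕ) : Q.map (Y n) = stepLaw a b := by
  have : IsFiniteMeasure (stepLaw a b) := by
    constructor
    simp [stepLaw]
  ext B hB
  rw [← measureReal_eq_measureReal_iff, map_measureReal_apply (h.meas n) hB]
  have := h.fact ha hb hab n (A := Set.univ) MeasurableSet.univ hB
  simpa using this

lemma StepHyp.indep (h : StepHyp Q Y F a b) (ha : 0 ≤ a) (hb : 0 ≤ b) (hab : a + b ≤ 1) :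
    iIndepFun Y Q := by
  rw [iIndepFun_iff_measure_inter_preimage_eq_mul]
  intro S B hB
  have key : Q.real (⋂ i ∈ S, Y i ⁻¹' B i) = ∏ i ∈ S, Q.real (Y i ⁻¹' B i) := by
    induction S using Finset.induction_on_max with
    | empty => simp
    | insert n S hS ih =>
      have hn : n ∉ S := fun hn => lt_irrefl _ (hS n hn)
      have hBn := hB n (Finset.mem_insert_self _ _)
      rw [Finset.prod_insert hn, Finset.set_biInter_insert, Set.inter_comm,
        h.fact ha hb hab n _ hBn, ih fun i hi => hB i (Finset.mem_insert_of_mem hi), mul_comm]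
      · congr 1
        rw [← h.law ha hb hab n, map_measureReal_apply (h.meas n) hBn]
      · exact Finset.measurableSet_biInter _ fun i hi =>
          h.adapt i n (hS i hi) (hB i (Finset.mem_insert_of_mem hi))
  rw [← ENNReal.toReal_eq_toReal_iff' (by simp) (ENNReal.prod_ne_top (by simp)),
    ENNReal.toReal_prod]
  exact key

lemma StepHyp.ident (h : StepHyp Q Y F a b) (ha : 0 ≤ a) (hb : 0 ≤ b) (hab : a + b ≤ 1)
    (n : ℕ) : IdentDistrib (Y n) (Y 0) Q Q :=
  ⟨(h.meas n).aemeasurable, (h.meas 0).aemeasurable, by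
    rw [h.law ha hb hab, h.law ha hb hab]⟩

lemma StepHyp.integral (h : StepHyp Q Y F a b) (ha : 0 ≤ a) (hb : 0 ≤ b) (hab : a + b ≤ 1)
    {f : ℝ → ℝ} (hf : Measurable f) :
    ∫ ω, f (Y 0 ω) ∂Q = a * f 1 + b * f (-1) + (1 - a - b) * f 0 := by
  rw [← integral_stepLaw ha hb hab, ← h.law ha hb hab 0,
    integral_map (h.meas 0).aemeasurable hf.aestronglyMeasurable]

lemma StepHyp.lln (h : StepHyp Q Y F a b) (ha : 0 ≤ a) (hb : 0 ≤ b) (hab : a + b ≤ 1) :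
    ∀ᵐ ω ∂Q, Tendsto (fun n : ℕ => (∑ k ∈ Finset.range n, Y k ω) / n) atTop (𝓝 (a - b)) := by
  have hm : ∫ ω, Y 0 ω ∂Q = a - b := by
    have := h.integral ha hb hab (f := fun x => x) measurable_id
    rw [this]; ring
  rw [← hm]
  refine strong_law_ae_real Y ?_ (fun i j hij => (h.indep ha hb hab).indepFun hij)
    (h.ident ha hb hab)
  refine Integrable.of_bound (h.meas 0).aestronglyMeasurable 1 (ae_of_all _ fun ω => ?_)
  rcases h.val 0 ω with h | h | h <;> simp [h]

lemma StepHyp.clt (h : StepHyp Q Y F a b) (ha : 0 ≤ a) (hb : 0 ≤ b) (hab : a + b ≤ 1)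
    (hv : 0 < a + b - (a - b) ^ 2) (R : ℕ → Ω → ℝ) (hRm : ∀ n, Measurable (R n))
    (C : ℝ) (hR : ∀ n ω, |R n ω| ≤ C)
    (f : BoundedContinuousFunction ℝ ℝ) :
    Tendsto (fun n : ℕ => ∫ ω, f ((∑ k ∈ Finset.range n, Y k ω - n * (a - b) + R n ω)
      / √(n * (a + b - (a - b) ^ 2))) ∂Q) atTop (𝓝 (∫ x, f x ∂(gaussianReal 0 1))) := by
  set v := a + b - (a - b) ^ 2 with hvdef
  have hs : 0 < √v := Real.sqrt_pos.2 hv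
  have hs2 : √v ^ 2 = v := Real.sq_sqrt hv.le
  let g : ℝ → ℝ := fun x => (x - (a - b)) / √v
  have hg : Measurable g := by fun_prop
  have h1 := tendstoInDistribution_inv_sqrt_mul_sum (P := Q) (X := fun k ω => g (Y k ω))
    (P' := gaussianReal 0 1) (Y := id) HasLaw.id
    (by rw [h.integral ha hb hab hg]; simp only [g]; ring)
    (by
      have := h.integral ha hb hab (hg.pow_const 2)
      simp only [Pi.pow_apply]
      rw [this]; simp only [g, div_pow, hs2]; field_simp; rw [hvdef]; ring)
    ((h.indep ha hb hab).comp (fun _ => g) (fun _ => hg))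
    (fun i => (h.ident ha hb hab i).comp hg)
  have hlim : Tendsto (fun n : ℕ => C / √(n * v)) atTop (𝓝 0) := by
    refine Tendsto.const_div_atTop (Real.tendsto_sqrt_atTop.comp ?_) C
    exact tendsto_natCast_atTop_atTop.atTop_mul_const hv
  have hRt : TendstoInMeasure Q (fun (n : ℕ) ω => R n ω / √(n * v)) atTop (fun _ => (0 : ℝ)) := by
    refine tendstoInMeasure_of_tendsto_ae
      (fun n => ((hRm n).div_const _).aestronglyMeasurable) (ae_of_all _ fun ω => ?_)
    refine squeeze_zero_norm (fun n => ?_) hlim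
    rw [norm_div, Real.norm_eq_abs, Real.norm_of_nonneg (Real.sqrt_nonneg _)]
    gcongr
    exact hR n ω
  have h2 := h1.add_of_tendstoInMeasure_const hRt (fun n => ((hRm n).div_const _).aemeasurable)
  have h3 := (ProbabilityMeasure.tendsto_iff_forall_integral_tendsto.1 h2.tendsto) f
  simp only [ProbabilityMeasure.coe_mk] at h3
  have hid : (fun ω : ℝ => id ω + 0) = id := by ext; simp
  rw [hid, Measure.map_id] at h3
  refine h3.congr fun n => ?_
  rw [integral_map (h2.forall_aemeasurable n) f.continuous.aestronglyMeasurable]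
  refine integral_congr_ae (ae_of_all _ fun ω => ?_)
  simp only [Pi.add_apply]
  congr 1
  simp only [g]
  rw [← Finset.sum_div, Finset.sum_sub_distrib, Real.sqrt_mul (Nat.cast_nonneg n)]
  simp only [Finset.sum_const, Finset.card_range, nsmul_eq_mul]
  rw [add_div]
  congr 1
  rw [div_eq_mul_inv, div_eq_mul_inv, mul_inv]
  ring

end core

lemma condExp_const_on {Ω : Type*} {m0 : MeasurableSpace Ω} {P : Measure Ω}
    [IsProbabilityMeasure P] {m : MeasurableSpace Ω} (hm : m ≤ m0) {E T : Set Ω} {g : Ω → ℝ}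
    (hE : MeasurableSet[m0] E) (hT : MeasurableSet[m] T)
    (hg : P[Set.indicator E (fun _ => (1 : ℝ)) | m] =ᵐ[P] g) (c : ℝ) (hc : ∀ ω ∈ T, g ω = c) :
    P.real (T ∩ E) = c * P.real T := by
  have h1 := setIntegral_condExp (μ := P) hm (f := Set.indicator E (fun _ => (1 : ℝ)))
    ((integrable_const 1).indicator hE) hT
  have h2 : ∫ ω in T, (P[Set.indicator E (fun _ => (1 : ℝ)) | m]) ω ∂P = ∫ ω in T, c ∂P := by
    refine setIntegral_congr_ae (hm _ hT) ?_
    filter_upwards [hg] with ω hω hT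
    rw [hω, hc ω hT]
  rw [h2, setIntegral_indicator hE] at h1
  simp only [setIntegral_const, smul_eq_mul, mul_one] at h1
  rw [← h1, mul_comm]

lemma sigmaUpTo_meas {Ω : Type*} (X : ℕ → Ω → ℝ) {k n : ℕ} (hk : k < n) :
    Measurable[sigmaUpTo X n] (X (k + 1)) := by
  have h : Measurable[sigmaUpTo X n] (fun ω (k : Fin n) => X ((k : ℕ) + 1) ω) :=
    comap_measurable _
  exact (measurable_pi_apply (⟨k, hk⟩ : Fin n)).comp h

lemma sigmaUpTo_le {Ω : Type*} [MeasurableSpace Ω] (X : ℕ → Ω → ℝ)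
    (hX : ∀ n, Measurable (X n)) (n : ℕ) : sigmaUpTo X n ≤ ‹MeasurableSpace Ω› := by
  have : Measurable (fun ω (k : Fin n) => X ((k : ℕ) + 1) ω) :=
    measurable_pi_lambda _ fun k => hX _
  exact this.comap_le

lemma stepHyp_cond {Ω : Type*} [MeasurableSpace Ω] {P : Measure Ω} [IsProbabilityMeasure P]
    {X : ℕ → Ω → ℝ} (hXmeas : ∀ n, Measurable (X n))
    (hXval : ∀ n, 1 ≤ n → ∀ ω, X n ω = 1 ∨ X n ω = -1 ∨ X n ω = 0) {gp gq : Ω → ℝ}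
    (hcondp : ∀ n : ℕ, 1 ≤ n →
      P[Set.indicator {ω | X (n + 1) ω = 1} (fun _ => (1 : ℝ)) | sigmaUpTo X n] =ᵐ[P] gp)
    (hcondq : ∀ n : ℕ, 1 ≤ n →
      P[Set.indicator {ω | X (n + 1) ω = -1} (fun _ => (1 : ℝ)) | sigmaUpTo X n] =ᵐ[P] gq)
    (v a b : ℝ) (hgp : ∀ ω, X 1 ω = v → gp ω = a) (hgq : ∀ ω, X 1 ω = v → gq ω = b) :
    StepHyp (P[|{ω | X 1 ω = v}]) (fun n => X (n + 2)) (fun n => sigmaUpTo X (n + 1)) a b := by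
  have hsv : ∀ k w, MeasurableSet {ω | X k ω = w} := fun k w =>
    hXmeas k (measurableSet_singleton w)
  have key : ∀ (n : ℕ) (w c : ℝ) (g : Ω → ℝ), (∀ ω, X 1 ω = v → g ω = c) →
      P[Set.indicator {ω | X (n + 2) ω = w} (fun _ => (1 : ℝ)) | sigmaUpTo X (n + 1)] =ᵐ[P] g →
      ∀ A, MeasurableSet[sigmaUpTo X (n + 1)] A →
      (P[|{ω | X 1 ω = v}]).real (A ∩ {ω | X (n + 2) ω = w})
        = c * (P[|{ω | X 1 ω = v}]).real A := by
    intro n w c g hg hP A hA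
    have hs : MeasurableSet[sigmaUpTo X (n + 1)] {ω | X 1 ω = v} :=
      sigmaUpTo_meas X (Nat.succ_pos n) (measurableSet_singleton v)
    have := condExp_const_on (sigmaUpTo_le X hXmeas (n + 1)) (hsv _ w) (hs.inter hA) hP c
      (fun ω hω => hg ω hω.1)
    have cra : ∀ t, (P[|{ω | X 1 ω = v}]).real t
        = (P.real {ω | X 1 ω = v})⁻¹ * P.real ({ω | X 1 ω = v} ∩ t) := by
      intro t
      simp only [Measure.real]
      rw [cond_apply (hsv _ _), ENNReal.toReal_mul, ENNReal.toReal_inv]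
    rw [cra, cra, ← Set.inter_assoc, this]
    ring
  exact
    { meas := fun n => hXmeas _
      val := fun n => hXval _ (by omega)
      le := fun n => sigmaUpTo_le X hXmeas _
      adapt := fun k n hk => sigmaUpTo_meas X (by omega)
      one := fun n => key n 1 a gp hgp (hcondp (n + 1) (by omega))
      neg := fun n => key n (-1) b gq hgq (hcondq (n + 1) (by omega)) }

/-- for the ERWD remembering only the first step, with random
normalization: (a) `(Sₙ − n(p−q)X₁)/√(n(p+q−(p−q)²))` converges in distribution to
`(p+q)·N(0,1) + r·δ₀`; (b) `(Sₙ − n(p−q)X₁)/n → 0` almost surely. -/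
theorem erwd_first_step_memory_random_normalization
    {Ω : Type*} [MeasurableSpace Ω] (P : Measure Ω) [IsProbabilityMeasure P]
    (p q r : ℝ) (hp : 0 < p) (hp1 : p < 1) (hq : 0 < q) (hq1 : q < 1)
    (hr : 0 < r) (hr1 : r < 1) (hpqr : p + q + r = 1)
    (X : ℕ → Ω → ℝ) (hXmeas : ∀ n, Measurable (X n))
    (hXval : ∀ n, 1 ≤ n → ∀ ω, X n ω = 1 ∨ X n ω = -1 ∨ X n ω = 0)
    (hX1p : P {ω | X 1 ω = 1} = ENNReal.ofReal p)
    (hX1q : P {ω | X 1 ω = -1} = ENNReal.ofReal q)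
    (hX1r : P {ω | X 1 ω = 0} = ENNReal.ofReal r)
    (hcondp : ∀ n : ℕ, 1 ≤ n →
      P[Set.indicator {ω | X (n + 1) ω = 1} (fun _ => (1 : ℝ)) | sigmaUpTo X n]
        =ᵐ[P] fun ω =>
          p * (if X 1 ω = 1 then (1 : ℝ) else 0) + q * (if X 1 ω = -1 then (1 : ℝ) else 0))
    (hcondq : ∀ n : ℕ, 1 ≤ n →
      P[Set.indicator {ω | X (n + 1) ω = -1} (fun _ => (1 : ℝ)) | sigmaUpTo X n]
        =ᵐ[P] fun ω =>
          q * (if X 1 ω = 1 then (1 : ℝ) else 0) + p * (if X 1 ω = -1 then (1 : ℝ) else 0))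
    (S : ℕ → Ω → ℝ) (hS : ∀ n ω, S n ω = ∑ k ∈ Finset.Icc 1 n, X k ω)
    :
    TendstoInDist
      (fun n : ℕ =>
        Measure.map
          (fun ω =>
            (S n ω - n * (p - q) * X 1 ω) / Real.sqrt (n * (p + q - (p - q) ^ 2))) P)
      (ENNReal.ofReal (p + q) • gaussianReal 0 1 + ENNReal.ofReal r • Measure.dirac 0) ∧
    (∀ᵐ ω ∂P,
      Tendsto (fun n : ℕ => (S n ω - n * (p - q) * X 1 ω) / n) atTop (𝓝 0)) := by
  have hsv : ∀ k w, MeasurableSet {ω | X k ω = w} := fun k w =>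
    hXmeas k (measurableSet_singleton w)
  have hne : ∀ {c v : ℝ}, 0 < c → P {ω | X 1 ω = v} = ENNReal.ofReal c →
      P {ω | X 1 ω = v} ≠ 0 := by
    intro c v hc h
    rw [h]
    simpa using hc
  have hpr1 := cond_isProbabilityMeasure (hne hp hX1p)
  have hpr2 := cond_isProbabilityMeasure (hne hq hX1q)
  have hpr3 := cond_isProbabilityMeasure (hne hr hX1r)
  have H1 := stepHyp_cond hXmeas hXval hcondp hcondq 1 p q
    (by intro ω h; simp only [h]; norm_num) (by intro ω h; simp only [h]; norm_num)
  have H2 := stepHyp_cond hXmeas hXval hcondp hcondq (-1) q p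
    (by intro ω h; simp only [h]; norm_num) (by intro ω h; simp only [h]; norm_num)
  have H3 := stepHyp_cond hXmeas hXval hcondp hcondq 0 0 0
    (by intro ω h; simp only [h]; norm_num) (by intro ω h; simp only [h]; norm_num)
  have hSsum : ∀ n ω, S n ω = ∑ k ∈ Finset.range n, X (k + 2) ω + (X 1 ω - X (n + 1) ω) := by
    intro n ω
    rw [hS]
    induction n with
    | zero => simp
    | succ n ih =>
      rw [Finset.sum_Icc_succ_top (by omega), ih, Finset.sum_range_succ]
      ring
  have hRm : ∀ n : ℕ, Measurable (fun ω => X 1 ω - X (n + 1) ω) := fun n =>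
    (hXmeas _).sub (hXmeas _)
  have hRb : ∀ (n : ℕ) ω, |X 1 ω - X (n + 1) ω| ≤ 2 := by
    intro n ω
    rcases hXval 1 le_rfl ω with h | h | h <;>
      rcases hXval (n + 1) (by omega) ω with h' | h' | h' <;> rw [h, h'] <;> norm_num
  have hSm : ∀ n, Measurable (S n) := by
    intro n
    have : S n = fun ω => ∑ k ∈ Finset.Icc 1 n, X k ω := funext (hS n)
    rw [this]
    exact Finset.measurable_sum _ fun k _ => hXmeas k
  -- the three parts in the law of large numbers
  have lln : ∀ (v a b : ℝ), P {ω | X 1 ω = v} ≠ 0 → a - b = (p - q) * v →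
      0 ≤ a → 0 ≤ b → a + b ≤ 1 →
      StepHyp (P[|{ω | X 1 ω = v}]) (fun n => X (n + 2)) (fun n => sigmaUpTo X (n + 1)) a b →
      ∀ᵐ ω ∂P, X 1 ω = v →
        Tendsto (fun n : ℕ => (S n ω - n * (p - q) * X 1 ω) / n) atTop (𝓝 0) := by
    intro v a b hv hab ha hb hab1 H
    have := cond_isProbabilityMeasure hv
    have h1 := H.lln ha hb hab1
    have h2 : ∀ᵐ ω ∂(P.restrict {ω | X 1 ω = v}), Tendsto
        (fun n : ℕ => (∑ k ∈ Finset.range n, X (k + 2) ω) / n) atTop (𝓝 (a - b)) := by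
      rw [ProbabilityTheory.cond] at h1
      exact (Measure.ae_ennreal_smul_measure_iff (ENNReal.inv_ne_zero.2 (measure_ne_top _ _))).1 h1
    rw [ae_restrict_iff' (hsv 1 v)] at h2
    filter_upwards [h2] with ω hω hv
    have h3 := hω hv
    have h4 : Tendsto (fun n : ℕ => (X 1 ω - X (n + 1) ω) / n) atTop (𝓝 0) := by
      refine squeeze_zero_norm (fun n => ?_)
        (Tendsto.const_div_atTop tendsto_natCast_atTop_atTop (2 : ℝ))
      rw [norm_div, Real.norm_eq_abs, Real.norm_natCast]
      gcongr
      exact hRb n ω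
    have h5 := (h3.sub_const (a - b)).add h4
    rw [sub_self, add_zero] at h5
    refine h5.congr' ?_
    filter_upwards [eventually_gt_atTop 0] with n hn
    have hn' : (n : ℝ) ≠ 0 := by exact_mod_cast hn.ne'
    rw [hSsum, hv, hab]
    field_simp
    ring
  have hvar : 0 < p + q - (p - q) ^ 2 := by nlinarith [mul_pos hp hq]
  have hvar' : q + p - (q - p) ^ 2 = p + q - (p - q) ^ 2 := by ring
  refine ⟨?_, ?_⟩
  · intro f
    set Z : ℕ → Ω → ℝ := fun n ω =>
      (S n ω - n * (p - q) * X 1 ω) / Real.sqrt (n * (p + q - (p - q) ^ 2)) with hZ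
    have hZm : ∀ n, Measurable (Z n) := fun n =>
      ((hSm n).sub ((hXmeas 1).const_mul _)).div_const _
    have hfi : ∀ n (μ : Measure Ω) [IsFiniteMeasure μ], Integrable (fun ω => f (Z n ω)) μ := by
      intro n μ _
      exact Integrable.of_bound (f.continuous.measurable.comp (hZm n)).aestronglyMeasurable ‖f‖
        (ae_of_all _ fun ω => f.norm_coe_le_norm _)
    have hci : ∀ (v c : ℝ), 0 < c → P {ω | X 1 ω = v} = ENNReal.ofReal c → ∀ g : Ω → ℝ,
        ∫ ω in {ω | X 1 ω = v}, g ω ∂P = c * ∫ ω, g ω ∂(P[|{ω | X 1 ω = v}]) := by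
      intro v c hc h g
      rw [ProbabilityTheory.cond, integral_smul_measure, h, ENNReal.toReal_inv,
        ENNReal.toReal_ofReal hc.le, smul_eq_mul, mul_inv_cancel_left₀ hc.ne']
    have hsplit : ∀ n, ∫ x, f x ∂(P.map (Z n)) =
        p * ∫ ω, f (Z n ω) ∂(P[|{ω | X 1 ω = 1}]) + q * ∫ ω, f (Z n ω) ∂(P[|{ω | X 1 ω = -1}])
          + r * ∫ ω, f (Z n ω) ∂(P[|{ω | X 1 ω = 0}]) := by
      intro n
      rw [integral_map (hZm n).aemeasurable f.continuous.aestronglyMeasurable,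
        ← hci 1 p hp hX1p, ← hci (-1) q hq hX1q, ← hci 0 r hr hX1r,
        ← setIntegral_union _ (hsv _ _) (hfi n _) (hfi n _),
        ← setIntegral_union _ (hsv _ _) (hfi n _) (hfi n _)]
      · rw [← setIntegral_univ]
        congr 2
        ext ω
        have := hXval 1 le_rfl ω
        simp only [Set.mem_univ, Set.mem_union, Set.mem_ofPred_eq]
        tauto
      · rw [Set.disjoint_left]
        rintro ω (h1 | h1) h2 <;> simp only [Set.mem_ofPred_eq] at h1 h2 <;>
          rw [h1] at h2 <;> norm_num at h2
      · rw [Set.disjoint_left]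
        rintro ω h1 h2
        simp only [Set.mem_ofPred_eq] at h1 h2
        rw [h1] at h2; norm_num at h2
    have hae : ∀ v : ℝ, ∀ᵐ ω ∂(P[|{ω | X 1 ω = v}]), X 1 ω = v := fun v =>
      ae_cond_mem (hsv 1 v)
    have hlim1 : Tendsto (fun n => ∫ ω, f (Z n ω) ∂(P[|{ω | X 1 ω = 1}])) atTop
        (𝓝 (∫ x, f x ∂(gaussianReal 0 1))) := by
      refine (H1.clt hp.le hq.le (by linarith) hvar _ hRm 2 hRb f).congr fun n => ?_
      refine integral_congr_ae ?_
      filter_upwards [hae 1] with ω hω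
      simp only [hZ, hSsum, hω]
      congr 2
      ring
    have hlim2 : Tendsto (fun n => ∫ ω, f (Z n ω) ∂(P[|{ω | X 1 ω = -1}])) atTop
        (𝓝 (∫ x, f x ∂(gaussianReal 0 1))) := by
      refine (H2.clt hq.le hp.le (by linarith) (by rw [hvar']; exact hvar)
        _ hRm 2 hRb f).congr fun n => ?_
      refine integral_congr_ae ?_
      filter_upwards [hae (-1)] with ω hω
      simp only [hZ, hSsum, hω, hvar']
      congr 2
      ring
    have hzero : ∀ᵐ ω ∂(P[|{ω | X 1 ω = 0}]), ∀ n, X (n + 2) ω = 0 := by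
      rw [ae_all_iff]
      intro n
      have e1 := H3.one n Set.univ MeasurableSet.univ
      have e2 := H3.neg n Set.univ MeasurableSet.univ
      rw [zero_mul, Set.univ_inter, measureReal_eq_zero_iff] at e1 e2
      have e1' := measure_eq_zero_iff_ae_notMem.1 e1
      have e2' := measure_eq_zero_iff_ae_notMem.1 e2
      filter_upwards [e1', e2'] with ω w1 w2
      have := hXval (n + 2) (by omega) ω
      tauto
    have hlim3 : Tendsto (fun n => ∫ ω, f (Z n ω) ∂(P[|{ω | X 1 ω = 0}])) atTop
        (𝓝 (f 0)) := by
      refine tendsto_const_nhds.congr fun n => ?_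
      have : ∫ ω, f (Z n ω) ∂(P[|{ω | X 1 ω = 0}]) = ∫ ω, f 0 ∂(P[|{ω | X 1 ω = 0}]) := by
        refine integral_congr_ae ?_
        filter_upwards [hae 0, hzero] with ω hω hω2
        have hSn : S n ω = 0 := by
          rw [hSsum, hω]
          cases n with
          | zero => simp [hω]
          | succ n => simp [hω2]
        simp [hZ, hSn, hω]
      rw [this]; simp
    have htot := ((hlim1.const_mul p).add (hlim2.const_mul q)).add (hlim3.const_mul r)
    have hfin : ∫ x, f x ∂(ENNReal.ofReal (p + q) • gaussianReal 0 1
        + ENNReal.ofReal r • Measure.dirac 0) =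
        p * ∫ x, f x ∂(gaussianReal 0 1) + q * ∫ x, f x ∂(gaussianReal 0 1) + r * f 0 := by
      rw [integral_add_measure ((f.integrable _).smul_measure ENNReal.ofReal_ne_top)
        ((f.integrable _).smul_measure ENNReal.ofReal_ne_top), integral_smul_measure,
        integral_smul_measure, integral_dirac, ENNReal.toReal_ofReal (by linarith),
        ENNReal.toReal_ofReal hr.le, smul_eq_mul, smul_eq_mul]
      ring
    rw [hfin]
    exact htot.congr fun n => (hsplit n).symm
  · filter_upwards [lln 1 p q (hne hp hX1p) (by ring) hp.le hq.le (by linarith) H1,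
      lln (-1) q p (hne hq hX1q) (by ring) hq.le hp.le (by linarith) H2,
      lln 0 0 0 (hne hr hX1r) (by ring) le_rfl le_rfl (by norm_num) H3] with ω h1 h2 h3
    rcases hXval 1 le_rfl ω with h | h | h
    · exact h1 h
    · exact h2 h
    · exact h3 h
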